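/- Let G be a perfect Cayley graph of a finite group of order n with clique number ω, and suppose ω divides n. Then the vertex set of G can be partitioned into n/ω pairwise vertex-disjoint cliques, each of size ω; equivalently, G admits a proper vertex coloring with ω colors in which every color class has exactly n/ω vertices. -/

import Mathlib

open Finset

/-- The Cayley graph of a group `H` with connection set `S`: `g` and `h` are adjacent
iff `g ≠ h` and `g⁻¹ * h ∈ S` (or `h⁻¹ * g ∈ S`). -/
def cayleyGraph {H : Type*} [Group H] (S : Finset H) : SimpleGraph H :=
  SimpleGraph.fromRel (fun g h => g⁻¹ * h ∈ S)

/-- A graph is perfect if for every induced subgraph the chromatic number equals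
the clique number. -/
def IsPerfectGraph {V : Type*} (G : SimpleGraph V) : Prop :=
  ∀ s : Set V, (G.induce s).chromaticNumber = ((G.induce s).cliqueNum : ℕ∞)

section PerfectGraph

variable {V : Type*} [DecidableEq V] {G : SimpleGraph V}

/-- A clique and an independent set have at most one common vertex. -/
lemma card_inter_le_one_of_isClique_of_isIndepSet {K A : Finset V} (hK : G.IsClique (K : Set V))
    (hA : G.IsIndepSet (A : Set V)) : #(K ∩ A) ≤ 1 := by
  rw [Finset.card_le_one]
  intro x hx y hy
  rw [Finset.mem_inter] at hx hy
  by_contra hne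
  exact hA hx.2 hy.2 hne (hK hx.1 hy.1 hne)

variable [Fintype V]

/-- Weighted colorings with weights `0` and `1`: a perfect graph whose cliques meet `s` in at most
`m` vertices has `m` independent sets partitioning `s`. -/
lemma IsPerfectGraph.exists_indepSet_of_le_one (hG : IsPerfectGraph G) (m : ℕ) (w : V → ℕ)
    (hw : ∀ v, w v ≤ 1)
    (hm : ∀ K : Finset V, G.IsClique (K : Set V) → ∑ v ∈ K, w v ≤ m) :
    ∃ A : Fin m → Finset V, (∀ i, G.IsIndepSet (A i : Set V)) ∧
      ∀ v, ∑ i, (if v ∈ A i then 1 else 0) = w v := by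
  classical
  set s : Set V := {v | w v = 1}
  have hclique : (G.induce s).cliqueNum ≤ m := by
    obtain ⟨K, hK⟩ := (G.induce s).exists_isNClique_cliqueNum
    have hK' : G.IsClique ((K.map (Function.Embedding.subtype _) : Finset V) : Set V) := by
      intro x hx y hy hne
      simp only [Finset.coe_map, Set.mem_image, Finset.mem_coe] at hx hy
      obtain ⟨x, hx, rfl⟩ := hx
      obtain ⟨y, hy, rfl⟩ := hy
      exact hK.isClique hx hy fun h => hne (h ▸ rfl)
    have h := hm _ hK'
    rw [Finset.sum_map, Finset.sum_congr rfl fun x _ => x.2] at h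
    simpa [hK.card_eq] using h
  have hcol : (G.induce s).Colorable m := by
    rw [← SimpleGraph.chromaticNumber_le_iff_colorable, hG s]
    exact_mod_cast hclique
  obtain ⟨c⟩ := hcol
  refine ⟨fun i => univ.filter fun v => ∃ h : v ∈ s, c ⟨v, h⟩ = i, ?_, fun v => ?_⟩
  · intro i x hx y hy _ hadj
    simp only [Finset.coe_filter, Finset.mem_univ, true_and, Set.mem_ofPred_eq] at hx hy
    obtain ⟨hx, hxi⟩ := hx
    obtain ⟨hy, hyi⟩ := hy
    exact c.valid (v := ⟨x, hx⟩) (w := ⟨y, hy⟩) hadj (hxi.trans hyi.symm)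
  · by_cases hv : v ∈ s
    · have h1 : w v = 1 := hv
      simp [hv, h1]
    · have h1 : w v ≠ 1 := hv
      have h0 : w v = 0 := by have := hw v; omega
      simp [hv, h0]

/-- Weighted form of the replication lemma: in a perfect graph, if every clique has weight at most
`m`, then some `m` independent sets contain each vertex as often as its weight prescribes. -/
lemma IsPerfectGraph.exists_indepSet_weighted (hG : IsPerfectGraph G) (m : ℕ) (w : V → ℕ)
    (hm : ∀ K : Finset V, G.IsClique (K : Set V) → ∑ v ∈ K, w v ≤ m) :
    ∃ A : Fin m → Finset V, (∀ i, G.IsIndepSet (A i : Set V)) ∧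
      ∀ v, ∑ i, (if v ∈ A i then 1 else 0) = w v := by
  induction hN : ∑ v, w v using Nat.strong_induction_on generalizing m w with
  | _ N ih =>
  by_cases hw : ∀ v, w v ≤ 1
  · exact hG.exists_indepSet_of_le_one m w hw hm
  push Not at hw
  obtain ⟨v, hv⟩ := hw
  obtain ⟨A, hA, hAw⟩ := ih (∑ x, (w x - if x = v then 1 else 0))
    (by
      rw [← hN]
      refine Finset.sum_lt_sum (fun _ _ => Nat.sub_le _ _) ⟨v, Finset.mem_univ v, ?_⟩
      simp only [if_true]; omega) m (fun x => w x - if x = v then 1 else 0)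
    (fun K hK => (Finset.sum_le_sum fun _ _ => Nat.sub_le _ _).trans (hm K hK)) rfl
  obtain ⟨j, hj⟩ : ∃ j, v ∈ A j := by
    by_contra! h
    have := hAw v
    simp only [h, if_true, if_false, Finset.sum_const_zero] at this
    omega
  have hle : ∀ x, (if x ∈ A j then 1 else 0) ≤ w x := fun x =>
    (Finset.single_le_sum (f := fun i => if x ∈ A i then 1 else 0) (fun _ _ => Nat.zero_le _)
      (Finset.mem_univ j)).trans ((hAw x).le.trans (Nat.sub_le _ _))
  obtain ⟨m, rfl⟩ : ∃ k, m = k + 1 := ⟨m - 1, by have := j.2; omega⟩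
  have hrest : ∀ K : Finset V, G.IsClique (K : Set V) →
      ∑ x ∈ K, (w x - if x ∈ A j then 1 else 0) ≤ m := by
    intro K hK
    have hsplit : ∑ x ∈ K, (w x - if x ∈ A j then 1 else 0) + #(K ∩ A j) = ∑ x ∈ K, w x := by
      rw [← Finset.filter_mem_eq_inter, Finset.card_filter, ← Finset.sum_add_distrib]
      exact Finset.sum_congr rfl fun x _ => Nat.sub_add_cancel (hle x)
    rcases Nat.eq_zero_or_pos #(K ∩ A j) with h0 | hpos
    · have hvK : v ∉ K := fun h => by
        have : v ∈ K ∩ A j := Finset.mem_inter.2 ⟨h, hj⟩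
        rw [Finset.card_eq_zero.1 h0] at this
        simp at this
      have hwK : ∑ x ∈ K, w x = ∑ i, #(K ∩ A i) := by
        simp_rw [← Finset.filter_mem_eq_inter, Finset.card_filter]
        rw [Finset.sum_comm]
        refine Finset.sum_congr rfl fun x hx => ?_
        rw [hAw x, if_neg (fun h : x = v => hvK (h ▸ hx)), Nat.sub_zero]
      have hbound : ∑ i, #(K ∩ A i) < ∑ _i : Fin (m + 1), 1 :=
        Finset.sum_lt_sum
          (fun i _ => card_inter_le_one_of_isClique_of_isIndepSet hK (hA i))
          ⟨j, Finset.mem_univ j, by omega⟩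
      simp only [Finset.sum_const, Finset.card_univ, Fintype.card_fin, smul_eq_mul,
        mul_one] at hbound
      omega
    · have := hm K hK
      omega
  obtain ⟨B, hB, hBw⟩ := ih (∑ x, (w x - if x ∈ A j then 1 else 0))
    (by
      rw [← hN]
      refine Finset.sum_lt_sum (fun _ _ => Nat.sub_le _ _) ⟨v, Finset.mem_univ v, ?_⟩
      simp only [hj, if_true]; omega) m _ hrest rfl
  refine ⟨Fin.cons (A j) B, fun i => ?_, fun x => ?_⟩
  · refine Fin.cases ?_ (fun i => ?_) i
    · simpa using hA j
    · simpa using hB i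
  · rw [Fin.sum_univ_succ]
    simp only [Fin.cons_zero, Fin.cons_succ]
    rw [hBw x]
    exact Nat.add_sub_cancel' (hle x)

/-- In a perfect graph, every vertex set contains a clique meeting all of its largest independent
subsets. -/
lemma IsPerfectGraph.exists_isClique_inter_nonempty (hG : IsPerfectGraph G) (T : Finset V) {a : ℕ}
    (ha : 0 < a) (hT : ∀ B ⊆ T, G.IsIndepSet (B : Set V) → #B ≤ a) :
    ∃ K ⊆ T, G.IsClique (K : Set V) ∧
      ∀ B ⊆ T, G.IsIndepSet (B : Set V) → #B = a → (K ∩ B).Nonempty := by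
  classical
  by_contra! hcon
  choose! A hAT hAi hAc hAK using hcon
  let C : Finset (Finset V) := T.powerset.filter fun K => G.IsClique (K : Set V)
  have hC : ∀ K, K ∈ C ↔ K ⊆ T ∧ G.IsClique (K : Set V) := by simp [C]
  let w : V → ℕ := fun x => ∑ K ∈ C, if x ∈ A K then 1 else 0
  have hwsum : ∀ X : Finset V, ∑ x ∈ X, w x = ∑ K ∈ C, #(X ∩ A K) := by
    intro X
    simp_rw [← Finset.filter_mem_eq_inter, Finset.card_filter]
    exact Finset.sum_comm
  have hwT : ∀ x, x ∉ T → w x = 0 := by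
    intro x hx
    refine Finset.sum_eq_zero fun K hK => if_neg fun h => hx ?_
    exact hAT K ((hC K).1 hK).1 ((hC K).1 hK).2 h
  have hweight : ∀ X : Finset V, G.IsClique (X : Set V) → ∑ x ∈ X, w x ≤ #C - 1 := by
    intro X hX
    have hXT : X ∩ T ∈ C := (hC _).2
      ⟨Finset.inter_subset_right, hX.subset (by exact_mod_cast Finset.inter_subset_left)⟩
    have hlt : ∑ K ∈ C, #(X ∩ A K) < ∑ _K ∈ C, 1 := by
      refine Finset.sum_lt_sum (fun K hK => card_inter_le_one_of_isClique_of_isIndepSet hX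
        (hAi K ((hC K).1 hK).1 ((hC K).1 hK).2)) ⟨_, hXT, ?_⟩
      have h0 := hAK _ ((hC _).1 hXT).1 ((hC _).1 hXT).2
      rw [Finset.inter_assoc,
        Finset.inter_eq_right.2 (hAT _ ((hC _).1 hXT).1 ((hC _).1 hXT).2)] at h0
      simp [h0]
    rw [hwsum]
    simp only [Finset.sum_const, smul_eq_mul, mul_one] at hlt
    omega
  obtain ⟨B, hB, hBw⟩ := hG.exists_indepSet_weighted (#C - 1) w hweight
  have hBT : ∀ i, B i ⊆ T := by
    intro i x hx
    by_contra hxT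
    have h := (hBw x).trans (hwT x hxT)
    rw [Finset.sum_eq_zero_iff] at h
    simpa [hx] using h i (Finset.mem_univ i)
  have htotal : ∑ x, w x = #C * a := by
    rw [hwsum, Finset.sum_congr rfl fun K hK => ?_, Finset.sum_const, smul_eq_mul]
    rw [Finset.univ_inter]
    exact hAc K ((hC K).1 hK).1 ((hC K).1 hK).2
  have htotal' : ∑ x, w x = ∑ i, #(B i) := by
    rw [Finset.sum_congr rfl fun x _ => (hBw x).symm, Finset.sum_comm]
    simp
  have hle : ∑ i, #(B i) ≤ (#C - 1) * a := by
    refine (Finset.sum_le_sum fun i _ => hT _ (hBT i) (hB i)).trans ?_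
    simp
  have hpos : 0 < #C := Finset.card_pos.2 ⟨∅, (hC ∅).2 ⟨by simp, by simp⟩⟩
  have : (#C - 1) * a < #C * a := Nat.mul_lt_mul_of_pos_right (by omega) ha
  omega

/-- In a perfect graph, a vertex set without independent subsets of more than `a` vertices is
covered by `a` cliques. -/
lemma IsPerfectGraph.exists_isClique_cover (hG : IsPerfectGraph G) (a : ℕ) (T : Finset V)
    (hT : ∀ B ⊆ T, G.IsIndepSet (B : Set V) → #B ≤ a) :
    ∃ K : Fin a → Finset V, (∀ i, G.IsClique (K i : Set V)) ∧ ∀ v ∈ T, ∃ i, v ∈ K i := by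
  induction a generalizing T with
  | zero =>
    refine ⟨fun _ => ∅, fun i => i.elim0, fun v hv => ?_⟩
    have := hT {v} (by simpa using hv) (by simp [SimpleGraph.IsIndepSet])
    simp at this
  | succ a ih =>
    obtain ⟨K₀, -, hK₀, hmeet⟩ := hG.exists_isClique_inter_nonempty T a.succ_pos hT
    obtain ⟨K, hK, hcover⟩ := ih (T \ K₀) (by
      intro B hB hBi
      have hBT : B ⊆ T := hB.trans Finset.sdiff_subset
      by_contra hlt
      obtain ⟨x, hx⟩ := hmeet B hBT hBi (le_antisymm (hT B hBT hBi) (by omega))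
      rw [Finset.mem_inter] at hx
      exact (Finset.mem_sdiff.1 (hB hx.2)).2 hx.1)
    refine ⟨Fin.cons K₀ K, fun i => ?_, fun v hv => ?_⟩
    · refine Fin.cases ?_ (fun i => ?_) i
      · simpa using hK₀
      · simpa using hK i
    · by_cases hv₀ : v ∈ K₀
      · exact ⟨0, by simpa using hv₀⟩
      · obtain ⟨i, hi⟩ := hcover v (Finset.mem_sdiff.2 ⟨hv, hv₀⟩)
        exact ⟨i.succ, by simpa using hi⟩

end PerfectGraph

/-- If all fibers of a map have at most `q` elements, and its domain has `q` elements for each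
element of the codomain, then all fibers have exactly `q` elements. -/
lemma card_fiber_eq_of_le {α β : Type*} [Fintype α] [Fintype β] [DecidableEq β] (f : α → β) {q : ℕ}
    (hle : ∀ b, #{a | f a = b} ≤ q) (hcard : Fintype.card α = Fintype.card β * q) (b : β) :
    #{a | f a = b} = q := by
  have hsum : ∑ b, #{a | f a = b} = ∑ _b : β, q := by
    rw [← Finset.card_eq_sum_card_fiberwise (fun a _ => Finset.mem_coe.2 (Finset.mem_univ (f a)))]
    simp [hcard]
  exact (Finset.sum_eq_sum_iff_of_le fun b _ => hle b).1 hsum b (Finset.mem_univ b)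

/-- The clique–coclique bound for Cayley graphs. -/
lemma cayleyGraph_card_mul_card_le {H : Type*} [Group H] [Fintype H] [DecidableEq H] {S : Finset H}
    {A K : Finset H} (hA : (cayleyGraph S).IsIndepSet (A : Set H))
    (hK : (cayleyGraph S).IsClique (K : Set H)) : #A * #K ≤ Fintype.card H := by
  rw [← Finset.card_product, ← Finset.card_univ]
  refine Finset.card_le_card_of_injOn (fun p => p.1 * p.2⁻¹) (fun _ _ => by simp) ?_
  rintro ⟨a, k⟩ hak ⟨a', k'⟩ hak' heq
  simp only [Finset.coe_product, Set.mem_prod, Finset.mem_coe] at hak hak' heq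
  have hquot : a⁻¹ * a' = k⁻¹ * k' := by
    rw [inv_mul_eq_iff_eq_mul, ← mul_assoc, heq, inv_mul_cancel_right]
  have hquot' : a'⁻¹ * a = k'⁻¹ * k := by
    simpa using congrArg (·⁻¹) hquot
  have hkk : k = k' := by
    by_contra hne
    have haa : a ≠ a' := fun h => hne <| by
      rw [h, inv_mul_cancel] at hquot
      exact inv_mul_eq_one.1 hquot.symm
    have hadj := hK hak.2 hak'.2 hne
    refine hA hak.1 hak'.1 haa ?_
    rw [cayleyGraph, SimpleGraph.fromRel_adj] at hadj ⊢
    rw [hquot, hquot']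
    exact ⟨haa, hadj.2⟩
  subst hkk
  simpa using heq

theorem perfect_cayley_clique_partition {H : Type*} [Group H] [Fintype H]
    [DecidableEq H] (S : Finset H)
    (hS1 : (1 : H) ∉ S) (hSsymm : ∀ s ∈ S, s⁻¹ ∈ S)
    (hperf : IsPerfectGraph (cayleyGraph S))
    (hdvd : (cayleyGraph S).cliqueNum ∣ Fintype.card H) :
    (∃ f : H → Fin (Fintype.card H / (cayleyGraph S).cliqueNum),
      ∀ i, (cayleyGraph S).IsNClique (cayleyGraph S).cliqueNum
        (Finset.univ.filter (fun v : H => f v = i))) ∧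
    (∃ c : H → Fin (cayleyGraph S).cliqueNum,
      (∀ u v : H, (cayleyGraph S).Adj u v → c u ≠ c v) ∧
      ∀ i, (Finset.univ.filter (fun v : H => c v = i)).card
        = Fintype.card H / (cayleyGraph S).cliqueNum) := by
  classical
  set ω := (cayleyGraph S).cliqueNum with hω
  obtain ⟨K₀, hK₀⟩ := (cayleyGraph S).exists_isNClique_cliqueNum
  have hclique : ∀ K : Finset H, (cayleyGraph S).IsClique (K : Set H) → #K ≤ ω :=
    fun K hK => hK.card_le_cliqueNum
  have hωpos : 0 < ω :=
    (Finset.card_pos.2 (Finset.singleton_nonempty 1)).trans_le (hclique {1} (by simp))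
  have hindep : ∀ A : Finset H, (cayleyGraph S).IsIndepSet (A : Set H) →
      #A ≤ Fintype.card H / ω := by
    intro A hA
    rw [Nat.le_div_iff_mul_le hωpos, hω, ← hK₀.card_eq]
    exact cayleyGraph_card_mul_card_le hA hK₀.isClique
  constructor
  · obtain ⟨K, hK, hcover⟩ := hperf.exists_isClique_cover (Fintype.card H / ω) univ
      fun B _ hB => hindep B hB
    choose f hf using fun v => hcover v (Finset.mem_univ v)
    have hfiber : ∀ i, (cayleyGraph S).IsClique
        ((univ.filter fun v => f v = i : Finset H) : Set H) := by
      refine fun i => (hK i).subset fun v hv => ?_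
      obtain rfl : f v = i := by simpa using hv
      exact hf v
    refine ⟨f, fun i => ⟨hfiber i, ?_⟩⟩
    refine card_fiber_eq_of_le f (fun i => hclique _ (hfiber i)) ?_ i
    rw [Fintype.card_fin, Nat.div_mul_cancel hdvd]
  · obtain ⟨A, hA, hcover⟩ := hperf.exists_indepSet_weighted ω (fun _ => 1)
      fun K hK => by simpa using hclique K hK
    have hmem : ∀ v, ∃ i, v ∈ A i := by
      intro v
      by_contra! h
      simpa [h] using hcover v
    choose c hc using hmem
    have hfiber : ∀ i, (univ.filter fun v => c v = i) ⊆ A i := by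
      intro i v hv
      obtain rfl : c v = i := by simpa using hv
      exact hc v
    refine ⟨c, fun u v huv heq => ?_, fun i => ?_⟩
    · exact hA (c u) (hc u) (heq ▸ hc v) huv.ne huv
    · refine card_fiber_eq_of_le c (fun i => ?_) ?_ i
      · exact (Finset.card_le_card (hfiber i)).trans (hindep _ (hA i))
      · rw [Fintype.card_fin, Nat.mul_div_cancel' hdvd]
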